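/- Let R, C, μ > 0, let n ≥ 1 be an integer with Rμ/C ≥ n + 1, let 0 ≤ a < m < b with m ≤ 1, and let 0 < d < 2(m−a)(b−m)/(b−a). Suppose f_n(b) + f_n'(b)(m−b) < f_n(m), suppose there exists a tangent point ρ_t ∈ (m, b) satisfying f_n(ρ_t) + f_n'(ρ_t)(m − ρ_t) = f_n(m), and suppose d ≥ d₀ := 2(m−a)(ρ_t−m)/(ρ_t−a). Then inf_{P ∈ 𝒫(a,b,m,d)} ∫ f_n(ρ) dP(ρ) = (d/(2(m−a)))·f_n(a) + (1 − d/(2(m−a)))·f_n(ρ₂), where ρ₂ = (ad + 2m(a−m))/(d + 2(a−m)), and the infimum is attained by the two-point probability measure placing masses d/(2(m−a)) and 1 − d/(2(m−a)) at a and ρ₂ respectively. -/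

import Mathlib

open MeasureTheory

/-- The social benefit rate function `f_n` of Naor's observable M/M/1 queue. -/
noncomputable def socialRate (R C μ : ℝ) (n : ℕ) (ρ : ℝ) : ℝ :=
  if ρ = 1 then R * μ * ((n : ℝ) / ((n : ℝ) + 1)) - C * ((n : ℝ) / 2)
  else R * μ * (ρ * (1 - ρ ^ n) / (1 - ρ ^ (n + 1)))
      - C * (ρ / (1 - ρ) - ((n : ℝ) + 1) * ρ ^ (n + 1) / (1 - ρ ^ (n + 1)))

/-- The MAD ambiguity set: Borel probability measures supported on `[a,b]`
with mean `m` and mean-absolute deviation `d`. -/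
def MADSet (a b m d : ℝ) : Set (Measure ℝ) :=
  {P | IsProbabilityMeasure P ∧ P (Set.Icc a b)ᶜ = 0 ∧
    (∫ ρ, ρ ∂P) = m ∧ (∫ ρ, |ρ - m| ∂P) = d}

open Finset in
/-- The linear functional sending `φ` to `∑ cₖ φ(k)`, where `∑ cₖ ρᵏ` is the polynomial
`-(1 - ρ ^ (n + 1)) ^ 3` times the second derivative of the social benefit rate with `C = 1` and
`R * μ = n + 1 + s`. -/
noncomputable def coeffSum (n : ℕ) (s : ℝ) (φ : ℝ → ℝ) : ℝ :=
  2 * ∑ i ∈ range (n + 1), ∑ j ∈ range (n + 1), ∑ l ∈ range (n + 1), φ ((i : ℝ) + j + l)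
    + (n + 1) * s * n * φ (n - 1) - (n + 1) * (n + 2) * (n + 1 + s) * φ n
    + (n + 1) * (n + 2) * s * φ (2 * n) - (n + 1) * n * (n + 1 + s) * φ (2 * n + 1)

/-- The exponential sum `∑ cₖ w(k) exp (k t)` attached to `coeffSum`. -/
noncomputable def weightedExpSum (n : ℕ) (s : ℝ) (w : ℝ → ℝ) (t : ℝ) : ℝ :=
  coeffSum n s fun k => w k * Real.exp (k * t)

theorem hasDerivAt_weightedExpSum (n : ℕ) (s : ℝ) (w : ℝ → ℝ) (t : ℝ) :
    HasDerivAt (weightedExpSum n s w) (weightedExpSum n s (fun k => k * w k) t) t := by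
  have h (k : ℝ) : HasDerivAt (fun t => w k * Real.exp (k * t)) (k * w k * Real.exp (k * t)) t := by
    refine (((hasDerivAt_id' t).const_mul k).exp.const_mul (w k)).congr_deriv ?_
    ring
  unfold weightedExpSum coeffSum
  exact (((((HasDerivAt.fun_sum fun i _ => HasDerivAt.fun_sum fun j _ =>
    HasDerivAt.fun_sum fun l _ => h _).const_mul 2).add ((h _).const_mul _)).sub
    ((h _).const_mul _)).add ((h _).const_mul _)).sub ((h _).const_mul _)

theorem weightedExpSum_sub_mul (n : ℕ) (s c : ℝ) (w : ℝ → ℝ) (t : ℝ) :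
    weightedExpSum n s (fun k => (k - c) * w k) t =
      weightedExpSum n s (fun k => k * w k) t - c * weightedExpSum n s w t := by
  unfold weightedExpSum coeffSum
  simp only [sub_mul, Finset.sum_sub_distrib, mul_assoc, ← Finset.mul_sum]
  ring

theorem weightedExpSum_zero (n : ℕ) (s : ℝ) (w : ℝ → ℝ) :
    weightedExpSum n s w 0 = coeffSum n s w := by
  simp [weightedExpSum]

theorem hasDerivAt_exp_mul_weightedExpSum (n : ℕ) (s c : ℝ) (w : ℝ → ℝ) (t : ℝ) :
    HasDerivAt (fun t => Real.exp (-c * t) * weightedExpSum n s w t)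
      (Real.exp (-c * t) * weightedExpSum n s (fun k => (k - c) * w k) t) t := by
  refine (((hasDerivAt_id' t).const_mul (-c)).exp.mul
    (hasDerivAt_weightedExpSum n s w t)).congr_deriv ?_
  rw [weightedExpSum_sub_mul]
  ring

theorem continuous_exp_mul_weightedExpSum (n : ℕ) (s c : ℝ) (w : ℝ → ℝ) :
    Continuous fun t => Real.exp (-c * t) * weightedExpSum n s w t :=
  continuous_iff_continuousAt.2 fun t => (hasDerivAt_exp_mul_weightedExpSum n s c w t).continuousAt

/-- A function on `(0, ∞)` that stays positive once it has been nonnegative. -/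
def StaysPos (p : ℝ → ℝ) : Prop := ∀ x y, 0 < x → x < y → 0 ≤ p x → 0 < p y

theorem strictMonoOn_exp_mul_weightedExpSum {n : ℕ} {s c : ℝ} {w : ℝ → ℝ} {D : Set ℝ}
    (hD : Convex ℝ D)
    (h : ∀ t ∈ interior D, 0 < weightedExpSum n s (fun k => (k - c) * w k) t) :
    StrictMonoOn (fun t => Real.exp (-c * t) * weightedExpSum n s w t) D := by
  refine strictMonoOn_of_deriv_pos hD (continuous_exp_mul_weightedExpSum n s c w).continuousOn ?_
  intro t ht
  rw [(hasDerivAt_exp_mul_weightedExpSum n s c w t).deriv]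
  exact mul_pos (Real.exp_pos _) (h t ht)

theorem StaysPos.of_sub_mul {n : ℕ} {s c : ℝ} {w : ℝ → ℝ} (h0 : coeffSum n s w = 0)
    (h : StaysPos (weightedExpSum n s fun k => (k - c) * w k)) :
    StaysPos (weightedExpSum n s w) := by
  intro x y hx hxy hpx
  obtain ⟨ξ, hξ, hd⟩ := exists_hasDerivAt_eq_slope
    (fun t => Real.exp (-c * t) * weightedExpSum n s w t) _ hx
    (continuous_exp_mul_weightedExpSum n s c w).continuousOn
    fun t _ => hasDerivAt_exp_mul_weightedExpSum n s c w t
  have hξ0 : 0 ≤ weightedExpSum n s (fun k => (k - c) * w k) ξ := by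
    refine nonneg_of_mul_nonneg_right (b := _) ?_ (Real.exp_pos (-c * ξ))
    rw [hd]
    simp only [weightedExpSum_zero, h0, mul_zero, sub_zero]
    positivity
  have hmono : StrictMonoOn (fun t => Real.exp (-c * t) * weightedExpSum n s w t) (Set.Ici ξ) := by
    refine strictMonoOn_exp_mul_weightedExpSum (convex_Ici ξ) fun t ht => ?_
    rw [interior_Ici] at ht
    exact h ξ t hξ.1 ht hξ0
  have := hmono (Set.mem_Ici.2 hξ.2.le) (Set.mem_Ici.2 (hξ.2.le.trans hxy.le)) hxy
  refine pos_of_mul_pos_right (a := Real.exp (-c * y)) (lt_of_le_of_lt ?_ this) (Real.exp_pos _).le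
  positivity

theorem weightedExpSum_neg_of_sub_mul_pos {n : ℕ} {s c : ℝ} {w : ℝ → ℝ}
    (h0 : coeffSum n s w ≤ 0)
    (h : ∀ t < 0, 0 < weightedExpSum n s (fun k => (k - c) * w k) t) :
    ∀ t < 0, weightedExpSum n s w t < 0 := by
  intro t ht
  have hmono : StrictMonoOn (fun t => Real.exp (-c * t) * weightedExpSum n s w t) (Set.Iic 0) :=
    strictMonoOn_exp_mul_weightedExpSum (convex_Iic 0) fun t ht => by
      rw [interior_Iic] at ht
      exact h t ht
  have := hmono (Set.mem_Iic.2 ht.le) (Set.mem_Iic.2 le_rfl) ht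
  simp only [mul_zero, Real.exp_zero, one_mul, weightedExpSum_zero] at this
  exact (pos_iff_neg_of_mul_neg (this.trans_le h0)).1 (Real.exp_pos _)

theorem weightedExpSum_neg (n : ℕ) (s : ℝ) (w : ℝ → ℝ) (t : ℝ) :
    weightedExpSum n s (fun k => -w k) t = -weightedExpSum n s w t := by
  unfold weightedExpSum coeffSum
  simp only [neg_mul, Finset.sum_neg_distrib]
  ring

theorem coeffSum_neg (n : ℕ) (s : ℝ) (w : ℝ → ℝ) :
    coeffSum n s (fun k => -w k) = -coeffSum n s w := by
  simpa [weightedExpSum_zero] using weightedExpSum_neg n s w 0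

theorem weightedExpSum_pos_of_sub_mul_neg {n : ℕ} {s c : ℝ} {w : ℝ → ℝ}
    (h0 : coeffSum n s w = 0)
    (h : ∀ t < 0, weightedExpSum n s (fun k => (k - c) * w k) t < 0) :
    ∀ t < 0, 0 < weightedExpSum n s w t := by
  intro t ht
  have := weightedExpSum_neg_of_sub_mul_pos (n := n) (s := s) (c := c) (w := fun k => -w k)
    (by rw [coeffSum_neg, h0, neg_zero])
    (fun t ht => by
      simp only [mul_neg]
      rw [weightedExpSum_neg]
      linarith [h t ht]) t ht
  rw [weightedExpSum_neg] at this
  linarith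

theorem sum_range_cubic (N : ℕ) (p q r u : ℝ) :
    ∑ i ∈ Finset.range N, (p + q * i + r * (i : ℝ) ^ 2 + u * (i : ℝ) ^ 3) =
      p * N + q * (N * (N - 1) / 2) + r * (N * (N - 1) * (2 * N - 1) / 6)
        + u * (N * (N - 1) / 2) ^ 2 := by
  induction N with
  | zero => simp
  | succ N ih =>
    rw [Finset.sum_range_succ, ih]
    push_cast
    ring

theorem sum_range_cubic_add (N : ℕ) (p q r u x : ℝ) :
    ∑ i ∈ Finset.range N, (p + q * (x + i) + r * (x + i) ^ 2 + u * (x + i) ^ 3) =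
      (p * N + q * (N * (N - 1) / 2) + r * (N * (N - 1) * (2 * N - 1) / 6)
        + u * (N * (N - 1) / 2) ^ 2)
      + (q * N + 2 * r * (N * (N - 1) / 2) + 3 * u * (N * (N - 1) * (2 * N - 1) / 6)) * x
      + (r * N + 3 * u * (N * (N - 1) / 2)) * x ^ 2 + u * N * x ^ 3 := by
  have h := sum_range_cubic N (p + q * x + r * x ^ 2 + u * x ^ 3)
    (q + 2 * r * x + 3 * u * x ^ 2) (r + 3 * u * x) u
  rw [← sub_eq_zero] at h ⊢
  rw [← h]
  have : ∀ i : ℕ, p + q * (x + i) + r * (x + i) ^ 2 + u * (x + i) ^ 3 =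
    (p + q * x + r * x ^ 2 + u * x ^ 3) + (q + 2 * r * x + 3 * u * x ^ 2) * i
      + (r + 3 * u * x) * (i : ℝ) ^ 2 + u * (i : ℝ) ^ 3 := fun i => by ring
  simp only [this]
  ring

theorem coeffSum_cubic (n : ℕ) (s p q r u : ℝ) :
    coeffSum n s (fun k => p + q * k + r * k ^ 2 + u * k ^ 3) =
      let N : ℝ := n + 1
      2 * N ^ 3 * (p + q * (3 * n / 2) + r * ((3 * n / 2) ^ 2 + n * (n + 2) / 4)
        + u * ((3 * n / 2) ^ 3 + 3 * (3 * n / 2) * (n * (n + 2) / 4)))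
      + (n + 1) * s * n * (p + q * (n - 1) + r * (n - 1) ^ 2 + u * (n - 1) ^ 3)
      - (n + 1) * (n + 2) * (n + 1 + s) * (p + q * n + r * n ^ 2 + u * n ^ 3)
      + (n + 1) * (n + 2) * s * (p + q * (2 * n) + r * (2 * n) ^ 2 + u * (2 * n) ^ 3)
      - (n + 1) * n * (n + 1 + s) *
        (p + q * (2 * n + 1) + r * (2 * n + 1) ^ 2 + u * (2 * n + 1) ^ 3) := by
  unfold coeffSum
  simp only [sum_range_cubic_add, sum_range_cubic]
  push_cast
  ring

theorem coeffSum_one (n : ℕ) (s : ℝ) : coeffSum n s (fun _ => 1) = 0 := by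
  have h := coeffSum_cubic n s 1 0 0 0
  simp only [zero_mul, add_zero] at h
  rw [h]
  ring

theorem coeffSum_linear (n : ℕ) (s : ℝ) : coeffSum n s (fun k => (k - n) * 1) = 0 := by
  have h := coeffSum_cubic n s (-n) 1 0 0
  rw [show (fun k : ℝ => (k - n) * 1) = fun k => -(n : ℝ) + 1 * k + 0 * k ^ 2 + 0 * k ^ 3 by
    ext k; ring, h]
  ring

theorem coeffSum_quadratic (n : ℕ) (s : ℝ) :
    coeffSum n s (fun k => (k - (2 * n + 1)) * ((k - n) * 1)) = 0 := by
  have h := coeffSum_cubic n s ((2 * n + 1) * n) (-(3 * n + 1)) 1 0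
  rw [show (fun k : ℝ => (k - (2 * n + 1)) * ((k - n) * 1)) =
    fun k => ((2 * n + 1) * n : ℝ) + (-(3 * n + 1)) * k + 1 * k ^ 2 + 0 * k ^ 3 by ext k; ring, h]
  ring

theorem coeffSum_cubic_nonpos (n : ℕ) {s : ℝ} (hs : 0 ≤ s) :
    coeffSum n s (fun k => (k - n) * ((k - (2 * n + 1)) * ((k - n) * 1))) ≤ 0 := by
  have h := coeffSum_cubic n s (-(2 * n + 1) * n ^ 2) ((2 * n + 1) * (2 * n) + n ^ 2)
    (-(4 * n + 1)) 1
  rw [show (fun k : ℝ => (k - n) * ((k - (2 * n + 1)) * ((k - n) * 1))) =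
    fun k => (-(2 * n + 1) * n ^ 2 : ℝ) + ((2 * n + 1) * (2 * n) + n ^ 2) * k
      + (-(4 * n + 1)) * k ^ 2 + 1 * k ^ 3 by ext k; ring, h]
  have : 0 ≤ (n + 1 : ℝ) ^ 3 * (n * (n + 2)) / 2 + (n + 1) * s * n * (n + 2) * (n + 1) := by
    positivity
  refine le_of_eq_of_le ?_ (neg_nonpos.2 this)
  ring

theorem weightedExpSum_quartic_pos {n : ℕ} (hn : 1 ≤ n) {s : ℝ} (hs : 0 ≤ s) (t : ℝ) :
    0 < weightedExpSum n s
      (fun k => (k - (2 * n + 1)) * ((k - n) * ((k - (2 * n + 1)) * ((k - n) * 1)))) t := by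
  have hn' : (1 : ℝ) ≤ n := by exact_mod_cast hn
  have hw : ∀ k : ℝ, (k - (2 * n + 1)) * ((k - n) * ((k - (2 * n + 1)) * ((k - n) * 1))) =
    ((k - (2 * n + 1)) * (k - n)) ^ 2 := fun k => by ring
  simp only [hw, weightedExpSum, coeffSum]
  simp only [sub_self, mul_zero, zero_mul, ne_eq, OfNat.ofNat_ne_zero, not_false_eq_true, zero_pow,
    sub_zero]
  have h0 : 0 < ∑ i ∈ Finset.range (n + 1), ∑ j ∈ Finset.range (n + 1),
      ∑ l ∈ Finset.range (n + 1), (((i : ℝ) + j + l - (2 * n + 1)) * ((i : ℝ) + j + l - n)) ^ 2 *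
        Real.exp (((i : ℝ) + j + l) * t) := by
    refine Finset.sum_pos' (fun i _ => by positivity) ⟨0, by simp, ?_⟩
    refine Finset.sum_pos' (fun i _ => by positivity) ⟨0, by simp, ?_⟩
    refine Finset.sum_pos' (fun i _ => by positivity) ⟨0, by simp, ?_⟩
    have : (((0 : ℕ) : ℝ) + (0 : ℕ) + (0 : ℕ) - (2 * n + 1)) *
      (((0 : ℕ) : ℝ) + (0 : ℕ) + (0 : ℕ) - n) ≠ 0 := by
      push_cast
      apply mul_ne_zero <;> linarith
    positivity
  positivity

theorem staysPos_weightedExpSum_one {n : ℕ} (hn : 1 ≤ n) {s : ℝ} (hs : 0 ≤ s) :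
    StaysPos (weightedExpSum n s fun _ => 1) := by
  refine .of_sub_mul (c := n) (coeffSum_one n s) ?_
  refine .of_sub_mul (c := 2 * n + 1) (coeffSum_linear n s) ?_
  refine .of_sub_mul (c := n) (coeffSum_quadratic n s) ?_
  intro x y _ hxy hx
  have hmono := strictMonoOn_exp_mul_weightedExpSum (n := n) (s := s) (c := 2 * n + 1)
    convex_univ fun t _ => weightedExpSum_quartic_pos hn hs t
  have := hmono (Set.mem_univ x) (Set.mem_univ y) hxy
  refine pos_of_mul_pos_right (a := Real.exp (-(2 * n + 1) * y)) (lt_of_le_of_lt ?_ this)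
    (Real.exp_pos _).le
  positivity

theorem weightedExpSum_one_pos {n : ℕ} (hn : 1 ≤ n) {s : ℝ} (hs : 0 ≤ s) :
    ∀ t < 0, 0 < weightedExpSum n s (fun _ => 1) t := by
  refine weightedExpSum_pos_of_sub_mul_neg (c := n) (coeffSum_one n s) ?_
  refine weightedExpSum_neg_of_sub_mul_pos (c := 2 * n + 1) (coeffSum_linear n s).le ?_
  refine weightedExpSum_pos_of_sub_mul_neg (c := n) (coeffSum_quadratic n s) ?_
  refine weightedExpSum_neg_of_sub_mul_pos (c := 2 * n + 1) (coeffSum_cubic_nonpos n hs) ?_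
  exact fun t _ => weightedExpSum_quartic_pos hn hs t

/-- A smooth expression for `socialRate` on `[0, ∞)`, without the removable singularity at `1`. -/
noncomputable def smoothRate (R C μ : ℝ) (n : ℕ) (ρ : ℝ) : ℝ :=
  (∑ i ∈ Finset.range (n + 1), (R * μ - C * i) * ρ ^ i - R * μ) / ∑ i ∈ Finset.range (n + 1), ρ ^ i

theorem geom_sum_range_succ_pos (n : ℕ) {ρ : ℝ} (hρ : 0 ≤ ρ) :
    0 < ∑ i ∈ Finset.range (n + 1), ρ ^ i := by
  rw [Finset.sum_range_succ']
  have : 0 ≤ ∑ i ∈ Finset.range n, ρ ^ (i + 1) := Finset.sum_nonneg fun i _ => by positivity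
  simpa using by linarith

theorem sum_range_mul_pow_mul_sq (N : ℕ) (ρ : ℝ) :
    (∑ i ∈ Finset.range (N + 1), (i : ℝ) * ρ ^ i) * (1 - ρ) ^ 2 =
      ρ - (N + 1) * ρ ^ (N + 1) + N * ρ ^ (N + 2) := by
  induction N with
  | zero => simp
  | succ N ih =>
    rw [Finset.sum_range_succ, add_mul, ih]
    push_cast
    ring

theorem one_sub_pow_succ_ne_zero (n : ℕ) {ρ : ℝ} (hρ : 0 ≤ ρ) (h1 : ρ ≠ 1) :
    1 - ρ ^ (n + 1) ≠ 0 := by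
  rw [sub_ne_zero]
  exact fun h => h1 ((pow_eq_one_iff_of_nonneg hρ (by simp)).1 h.symm)

theorem geom_sum_range_succ_eq_div (n : ℕ) {ρ : ℝ} (h1 : ρ ≠ 1) :
    ∑ i ∈ Finset.range (n + 1), ρ ^ i = (1 - ρ ^ (n + 1)) / (1 - ρ) := by
  rw [geom_sum_eq h1, ← neg_sub 1 (ρ ^ (n + 1)), ← neg_sub 1 ρ, neg_div_neg_eq]

theorem socialRate_eq_smoothRate (R C μ : ℝ) (n : ℕ) {ρ : ℝ} (hρ : 0 ≤ ρ) :
    socialRate R C μ n ρ = smoothRate R C μ n ρ := by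
  have hN : (n : ℝ) + 1 ≠ 0 := by positivity
  unfold socialRate smoothRate
  simp only [sub_mul, Finset.sum_sub_distrib, mul_assoc C, ← Finset.mul_sum]
  split_ifs with h
  · subst h
    have hs := sum_range_cubic (n + 1) 0 1 0 0
    simp only [zero_add, one_mul, zero_mul, add_zero] at hs
    simp only [one_pow, mul_one, hs]
    simp only [Finset.sum_const, Finset.card_range, nsmul_eq_mul]
    push_cast
    field_simp
    ring
  · have h1 : 1 - ρ ≠ 0 := sub_ne_zero.2 (Ne.symm h)
    have hD := one_sub_pow_succ_ne_zero n hρ h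
    rw [eq_div_of_mul_eq (pow_ne_zero 2 h1) (sum_range_mul_pow_mul_sq n ρ),
      geom_sum_range_succ_eq_div n h]
    field_simp
    ring

theorem socialRate_eq_partialFractions {R C μ : ℝ} (hC : C ≠ 0) (n : ℕ) {ρ : ℝ}
    (hρ : 0 ≤ ρ) (h1 : ρ ≠ 1) :
    socialRate R C μ n ρ = C * (R * μ / C - n - (1 - ρ)⁻¹
      + (R * μ / C * ρ - (R * μ / C - (n + 1))) / (1 - ρ ^ (n + 1))) := by
  have h1' : 1 - ρ ≠ 0 := sub_ne_zero.2 (Ne.symm h1)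
  have hD := one_sub_pow_succ_ne_zero n hρ h1
  rw [socialRate, if_neg h1]
  field_simp
  ring

theorem hasDerivAt_partialFractions (C r s : ℝ) (n : ℕ) {ρ : ℝ} (hρ : 0 ≤ ρ) (h1 : ρ ≠ 1) :
    HasDerivAt (fun ρ => C * (r - n - (1 - ρ)⁻¹ + (r * ρ - s) / (1 - ρ ^ (n + 1))))
      (C * (-((1 - ρ) ^ 2)⁻¹ + r / (1 - ρ ^ (n + 1))
        + (r * ρ - s) * ((n + 1) * ρ ^ n) / (1 - ρ ^ (n + 1)) ^ 2)) ρ := by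
  have h1' : 1 - ρ ≠ 0 := sub_ne_zero.2 (Ne.symm h1)
  have hD := one_sub_pow_succ_ne_zero n hρ h1
  have hden : HasDerivAt (fun ρ : ℝ => 1 - ρ ^ (n + 1)) (-((n + 1) * ρ ^ n)) ρ := by
    simpa using (hasDerivAt_pow (n + 1) ρ).const_sub 1
  have hnum : HasDerivAt (fun ρ : ℝ => r * ρ - s) r ρ := by
    simpa using ((hasDerivAt_id' ρ).const_mul r).sub_const s
  refine ((((((hasDerivAt_id' ρ).const_sub 1).fun_inv h1').const_sub (r - n)).add
    (hnum.div hden hD)).const_mul C).congr_deriv ?_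
  field_simp
  ring

theorem weightedExpSum_one_log (k : ℕ) (s : ℝ) {ρ : ℝ} (hρ : 0 < ρ) :
    weightedExpSum (k + 1) s (fun _ => 1) (Real.log ρ) =
      2 * (∑ i ∈ Finset.range (k + 2), ρ ^ i) ^ 3 + (k + 2) * s * (k + 1) * ρ ^ k
        - (k + 2) * (k + 3) * (k + 2 + s) * ρ ^ (k + 1) + (k + 2) * (k + 3) * s * ρ ^ (2 * k + 2)
        - (k + 2) * (k + 1) * (k + 2 + s) * ρ ^ (2 * k + 3) := by
  have he : ∀ i : ℕ, Real.exp (i * Real.log ρ) = ρ ^ i := fun i => by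
    rw [Real.exp_nat_mul, Real.exp_log hρ]
  have hsum : ∑ i ∈ Finset.range (k + 1 + 1), ∑ j ∈ Finset.range (k + 1 + 1),
      ∑ l ∈ Finset.range (k + 1 + 1), Real.exp (((i : ℝ) + j + l) * Real.log ρ) =
      (∑ i ∈ Finset.range (k + 2), ρ ^ i) ^ 3 := by
    simp only [add_mul, Real.exp_add, he, ← Finset.mul_sum, ← Finset.sum_mul]
    ring
  have e1 := he k
  have e2 := he (k + 1)
  have e3 := he (2 * k + 2)
  have e4 := he (2 * k + 3)
  push_cast at e1 e2 e3 e4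
  simp only [weightedExpSum, coeffSum, one_mul, hsum]
  push_cast
  rw [show (k + 1 - 1 : ℝ) = k by ring, show (2 * (k + 1) : ℝ) = 2 * k + 2 by ring,
    show (2 * k + 2 + 1 : ℝ) = 2 * k + 3 by ring, e1, e2, e3, e4]
  ring

theorem hasDerivAt_deriv_partialFractions (C s : ℝ) {n : ℕ} (hn : 1 ≤ n) {ρ : ℝ} (hρ : 0 < ρ)
    (h1 : ρ ≠ 1) :
    HasDerivAt (fun ρ => C * (-((1 - ρ) ^ 2)⁻¹ + (n + 1 + s) / (1 - ρ ^ (n + 1))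
        + ((n + 1 + s) * ρ - s) * ((n + 1) * ρ ^ n) / (1 - ρ ^ (n + 1)) ^ 2))
      (-C * weightedExpSum n s (fun _ => 1) (Real.log ρ) / (1 - ρ ^ (n + 1)) ^ 3) ρ := by
  obtain ⟨k, rfl⟩ := Nat.exists_eq_add_of_le' hn
  have h1' : 1 - ρ ≠ 0 := sub_ne_zero.2 (Ne.symm h1)
  have hD := one_sub_pow_succ_ne_zero (k + 1) hρ.le h1
  have hpow : HasDerivAt (fun ρ : ℝ => ρ ^ (k + 1)) ((k + 1) * ρ ^ k) ρ := by
    simpa using hasDerivAt_pow (k + 1) ρ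
  have hden : HasDerivAt (fun ρ : ℝ => 1 - ρ ^ (k + 1 + 1)) (-((k + 2) * ρ ^ (k + 1))) ρ := by
    refine ((hasDerivAt_pow (k + 1 + 1) ρ).const_sub 1).congr_deriv ?_
    push_cast
    ring
  have hnum : HasDerivAt (fun ρ : ℝ => (((k + 1 : ℕ) : ℝ) + 1 + s) * ρ - s) (k + 2 + s) ρ := by
    refine (((hasDerivAt_id' ρ).const_mul (((k + 1 : ℕ) : ℝ) + 1 + s)).sub_const s).congr_deriv ?_
    push_cast
    ring
  refine (((((((hasDerivAt_id' ρ).const_sub 1).fun_pow 2).fun_inv (pow_ne_zero 2 h1')).fun_neg.add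
    ((hasDerivAt_const ρ (((k + 1 : ℕ) : ℝ) + 1 + s)).fun_div hden hD)).add
    ((hnum.fun_mul (hpow.const_mul (((k + 1 : ℕ) : ℝ) + 1))).fun_div (hden.fun_pow 2)
      (pow_ne_zero 2 hD))).const_mul C).congr_deriv ?_
  rw [weightedExpSum_one_log k s hρ, geom_sum_range_succ_eq_div (k + 1) h1]
  push_cast
  have e1 : ρ ^ (k + 1) = ρ ^ k * ρ := by ring
  have e2 : ρ ^ (k + 1 + 1) = ρ ^ k * ρ ^ 2 := by ring
  have e3 : ρ ^ (2 * k + 2) = (ρ ^ k) ^ 2 * ρ ^ 2 := by ring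
  have e4 : ρ ^ (2 * k + 3) = (ρ ^ k) ^ 2 * ρ ^ 3 := by ring
  rw [e2, mul_comm] at hD
  simp only [e3, e4, e2, e1]
  generalize ρ ^ k = q at *
  field_simp
  ring

theorem contDiffAt_smoothRate (R C μ : ℝ) (n : ℕ) {ρ : ℝ} (hρ : 0 ≤ ρ) :
    ContDiffAt ℝ 2 (smoothRate R C μ n) ρ := by
  unfold smoothRate
  refine ContDiffAt.div ?_ ?_ (geom_sum_range_succ_pos n hρ).ne' <;> fun_prop

theorem continuousOn_smoothRate (R C μ : ℝ) (n : ℕ) :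
    ContinuousOn (smoothRate R C μ n) (Set.Ici 0) :=
  fun _ hρ => (contDiffAt_smoothRate R C μ n hρ).continuousAt.continuousWithinAt

theorem continuousAt_deriv_smoothRate (R C μ : ℝ) (n : ℕ) {ρ : ℝ} (hρ : 0 ≤ ρ) :
    ContinuousAt (deriv (smoothRate R C μ n)) ρ :=
  ((contDiffAt_smoothRate R C μ n hρ).derivWithin (m := 1) (by norm_num)).continuousAt

theorem deriv_socialRate_eq (R C μ : ℝ) (n : ℕ) {ρ : ℝ} (hρ : 0 < ρ) :
    deriv (socialRate R C μ n) ρ = deriv (smoothRate R C μ n) ρ := by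
  apply Filter.EventuallyEq.deriv_eq
  filter_upwards [lt_mem_nhds hρ] with x hx using socialRate_eq_smoothRate R C μ n hx.le

theorem deriv_deriv_smoothRate {R C μ : ℝ} (hC : C ≠ 0) {n : ℕ} (hn : 1 ≤ n) {ρ : ℝ} (hρ : 0 < ρ)
    (h1 : ρ ≠ 1) :
    deriv (deriv (smoothRate R C μ n)) ρ =
      -C * weightedExpSum n (R * μ / C - (n + 1)) (fun _ => 1) (Real.log ρ)
        / (1 - ρ ^ (n + 1)) ^ 3 := by
  have hderiv := fun (x : ℝ) (hx : 0 < x) (hx1 : x ≠ 1) =>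
    ((hasDerivAt_partialFractions C (R * μ / C) (R * μ / C - (n + 1)) n hx.le
      hx1).congr_of_eventuallyEq (f₁ := smoothRate R C μ n) (by
        filter_upwards [lt_mem_nhds hx, isOpen_ne.mem_nhds hx1] with y hy hy1
        rw [← socialRate_eq_smoothRate R C μ n hy.le,
          socialRate_eq_partialFractions hC n hy.le hy1])).deriv
  refine ((hasDerivAt_deriv_partialFractions C (R * μ / C - (n + 1)) hn hρ
    h1).congr_of_eventuallyEq ?_).deriv
  filter_upwards [lt_mem_nhds hρ, isOpen_ne.mem_nhds h1] with y hy hy1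
  rw [hderiv y hy hy1, add_sub_cancel]

theorem deriv_deriv_smoothRate_neg {R C μ : ℝ} (hC : 0 < C) {n : ℕ} (hn : 1 ≤ n)
    (hRC : (n : ℝ) + 1 ≤ R * μ / C) {ρ : ℝ} (hρ : 0 < ρ) (h1 : ρ < 1) :
    deriv (deriv (smoothRate R C μ n)) ρ < 0 := by
  rw [deriv_deriv_smoothRate hC.ne' hn hρ h1.ne]
  have hp := weightedExpSum_one_pos hn (sub_nonneg.2 hRC) _ (Real.log_neg hρ h1)
  have hD : 0 < 1 - ρ ^ (n + 1) := sub_pos.2 (pow_lt_one₀ hρ.le h1 (by simp))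
  exact div_neg_of_neg_of_pos (by nlinarith) (pow_pos hD 3)

theorem deriv_deriv_smoothRate_of_one_lt {R C μ : ℝ} (hC : C ≠ 0) {n : ℕ} (hn : 1 ≤ n) {ρ : ℝ}
    (h1 : 1 < ρ) :
    ∃ κ > 0, deriv (deriv (smoothRate R C μ n)) ρ =
      C * κ * weightedExpSum n (R * μ / C - (n + 1)) (fun _ => 1) (Real.log ρ) := by
  have hD : 0 < ρ ^ (n + 1) - 1 := sub_pos.2 (one_lt_pow₀ h1 (by simp))
  refine ⟨((ρ ^ (n + 1) - 1) ^ 3)⁻¹, by positivity, ?_⟩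
  rw [deriv_deriv_smoothRate hC hn (by linarith) h1.ne',
    show (1 - ρ ^ (n + 1)) ^ 3 = -(ρ ^ (n + 1) - 1) ^ 3 by ring]
  field_simp

theorem strictAntiOn_deriv_smoothRate {R C μ : ℝ} (hC : 0 < C) {n : ℕ} (hn : 1 ≤ n)
    (hRC : (n : ℝ) + 1 ≤ R * μ / C) {c : ℝ}
    (hc : ∀ x, 1 < x → x < c →
      weightedExpSum n (R * μ / C - (n + 1)) (fun _ => 1) (Real.log x) < 0) :
    StrictAntiOn (deriv (smoothRate R C μ n)) (Set.Ioc 0 c) := by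
  have h01 : StrictAntiOn (deriv (smoothRate R C μ n)) (Set.Ioc 0 1) := by
    refine strictAntiOn_of_deriv_neg (convex_Ioc 0 1) (fun x hx =>
      (continuousAt_deriv_smoothRate R C μ n hx.1.le).continuousWithinAt) fun x hx => ?_
    rw [interior_Ioc] at hx
    exact deriv_deriv_smoothRate_neg hC hn hRC hx.1 hx.2
  rcases le_total c 1 with h | h
  · exact h01.mono (Set.Ioc_subset_Ioc_right h)
  have h1c : StrictAntiOn (deriv (smoothRate R C μ n)) (Set.Icc 1 c) := by
    refine strictAntiOn_of_deriv_neg (convex_Icc 1 c) (fun x hx =>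
      (continuousAt_deriv_smoothRate R C μ n (zero_le_one.trans hx.1)).continuousWithinAt)
      fun x hx => ?_
    rw [interior_Icc] at hx
    obtain ⟨κ, hκ, he⟩ := deriv_deriv_smoothRate_of_one_lt (R := R) (μ := μ) hC.ne' hn hx.1
    rw [he]
    exact mul_neg_of_pos_of_neg (mul_pos hC hκ) (hc x hx.1 hx.2)
  rw [← Set.Ioc_union_Icc_eq_Ioc zero_lt_one h]
  exact h01.union h1c ⟨Set.right_mem_Ioc.2 zero_lt_one, fun _ hx => hx.2⟩ (isLeast_Icc h)

theorem exists_inflection_smoothRate {R C μ : ℝ} (hC : 0 < C) {n : ℕ} (hn : 1 ≤ n)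
    (hRC : (n : ℝ) + 1 ≤ R * μ / C) {m ρt : ℝ} (hm : 0 < m) (hmt : m < ρt)
    (htangent : smoothRate R C μ n ρt + deriv (smoothRate R C μ n) ρt * (m - ρt) =
      smoothRate R C μ n m) :
    ∃ c, 1 ≤ c ∧ c ≤ ρt ∧ AntitoneOn (deriv (smoothRate R C μ n)) (Set.Ioc 0 c) ∧
      MonotoneOn (deriv (smoothRate R C μ n)) (Set.Ici c) := by
  set p := weightedExpSum n (R * μ / C - (n + 1)) fun _ => 1
  have hdiff : ∀ x, 0 ≤ x → DifferentiableAt ℝ (smoothRate R C μ n) x := fun x hx =>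
    (contDiffAt_smoothRate R C μ n hx).differentiableAt (by norm_num)
  obtain ⟨x₀, hx₀1, hx₀t, hx₀⟩ : ∃ x, 1 < x ∧ x < ρt ∧ 0 ≤ p (Real.log x) := by
    by_contra! h
    have hanti := strictAntiOn_deriv_smoothRate hC hn hRC h
    obtain ⟨ξ, hξ, he⟩ := exists_deriv_eq_slope (smoothRate R C μ n) hmt
      ((continuousOn_smoothRate R C μ n).mono fun x hx => hm.le.trans hx.1)
      fun x hx => (hdiff x (hm.le.trans hx.1.le)).differentiableWithinAt
    have := hanti ⟨hm.trans hξ.1, hξ.2.le⟩ ⟨hm.trans hmt, le_rfl⟩ hξ.2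
    rw [he, lt_div_iff₀ (sub_pos.2 hmt)] at this
    linarith
  set A := {x | 1 < x ∧ 0 ≤ p (Real.log x)}
  have hA : x₀ ∈ A := ⟨hx₀1, hx₀⟩
  have hbdd : BddBelow A := ⟨1, fun x hx => hx.1.le⟩
  have h1c : 1 ≤ sInf A := le_csInf ⟨x₀, hA⟩ fun x hx => hx.1.le
  refine ⟨sInf A, h1c, (csInf_le hbdd hA).trans hx₀t.le, ?_, ?_⟩
  · refine (strictAntiOn_deriv_smoothRate hC hn hRC fun x hx hxc => ?_).antitoneOn
    by_contra! h
    exact notMem_of_lt_csInf hxc hbdd ⟨hx, h⟩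
  · refine (strictMonoOn_of_deriv_pos (convex_Ici _) (fun x hx =>
      (continuousAt_deriv_smoothRate R C μ n
        (zero_le_one.trans (h1c.trans hx))).continuousWithinAt) fun x hx => ?_).monotoneOn
    rw [interior_Ici] at hx
    obtain ⟨y, hy, hyx⟩ := exists_lt_of_csInf_lt ⟨x₀, hA⟩ hx
    obtain ⟨κ, hκ, he⟩ := deriv_deriv_smoothRate_of_one_lt (R := R) (μ := μ) hC.ne' hn
      (hy.1.trans hyx)
    rw [he]
    exact mul_pos (mul_pos hC hκ) (staysPos_weightedExpSum_one hn (sub_nonneg.2 hRC) _ _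
      (Real.log_pos hy.1) (Real.log_lt_log (by linarith [hy.1]) hyx) hy.2)

theorem ConvexOn.tangent_le {S : Set ℝ} {f : ℝ → ℝ} (hf : ConvexOn ℝ S f) {x y f' : ℝ}
    (hx : x ∈ S) (hy : y ∈ S) (hd : HasDerivAt f f' x) : f x + f' * (y - x) ≤ f y := by
  rcases lt_trichotomy x y with h | rfl | h
  · have := hf.le_slope_of_hasDerivAt hx hy h hd
    rw [slope_def_field, le_div_iff₀ (sub_pos.2 h)] at this
    linarith
  · simp
  · have := hf.slope_le_of_hasDerivAt hy hx h hd
    rw [slope_def_field, div_le_iff₀ (sub_pos.2 h)] at this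
    linarith

theorem ConcaveOn.affine_le {S : Set ℝ} {f : ℝ → ℝ} (hf : ConcaveOn ℝ S f) {x y z p q : ℝ}
    (hx : x ∈ S) (hy : y ∈ S) (hxz : x ≤ z) (hzy : z ≤ y)
    (hpx : p + q * x ≤ f x) (hpy : p + q * y ≤ f y) : p + q * z ≤ f z := by
  obtain ⟨u, v, hu, hv, huv, rfl⟩ := Icc_subset_segment (𝕜 := ℝ) ⟨hxz, hzy⟩
  have h := hf.2 hx hy hu hv huv
  simp only [smul_eq_mul] at h ⊢
  calc p + q * (u * x + v * y) = u * (p + q * x) + v * (p + q * y) := by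
        linear_combination -p * huv
    _ ≤ u * f x + v * f y := by gcongr
    _ ≤ _ := h

theorem kinked_minorant_of_concave_convex {h : ℝ → ℝ} {a m c ρt x : ℝ} (ha : 0 ≤ a) (ham : a < m)
    (hmc : m ≤ c) (hct : c ≤ ρt) (htx : ρt ≤ x)
    (hcont : ContinuousOn h (Set.Ici 0)) (hdiff : ∀ y, 0 < y → DifferentiableAt ℝ h y)
    (hanti : AntitoneOn (deriv h) (Set.Ioc 0 c)) (hmono : MonotoneOn (deriv h) (Set.Ici c))
    (htangent : h ρt + deriv h ρt * (m - ρt) = h m) :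
    let v := h x + deriv h x * (m - x)
    (∀ ρ, a ≤ ρ → ρ ≤ m → v + (v - h a) / (m - a) * (ρ - m) ≤ h ρ) ∧
      ∀ ρ, m ≤ ρ → v + deriv h x * (ρ - m) ≤ h ρ := by
  intro v
  have hm : 0 < m := ha.trans_lt ham
  have hc : 0 < c := hm.trans_le hmc
  have hconc : ConcaveOn ℝ (Set.Icc 0 c) h := by
    refine AntitoneOn.concaveOn_of_deriv (convex_Icc 0 c) (hcont.mono fun y hy => hy.1) ?_ ?_ <;>
      rw [interior_Icc]
    · exact fun y hy => (hdiff y hy.1).differentiableWithinAt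
    · exact hanti.mono Set.Ioo_subset_Ioc_self
  have hconv : ConvexOn ℝ (Set.Ici c) h := by
    refine MonotoneOn.convexOn_of_deriv (convex_Ici c)
      (hcont.mono (Set.Ici_subset_Ici.2 hc.le)) ?_ ?_ <;> rw [interior_Ici]
    · exact fun y hy => (hdiff y (hc.trans hy)).differentiableWithinAt
    · exact hmono.mono Set.Ioi_subset_Ici_self
  have hline : ∀ y, c ≤ y → h x + deriv h x * (y - x) ≤ h y := fun y hy =>
    hconv.tangent_le (Set.mem_Ici.2 (hct.trans htx)) hy
      (hdiff x (hc.trans_le (hct.trans htx))).hasDerivAt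
  have hvm : v ≤ h m := by
    have h1 := hline ρt hct
    have h2 : deriv h ρt ≤ deriv h x := hmono hct (hct.trans htx) htx
    have h3 : deriv h x * (m - ρt) ≤ deriv h ρt * (m - ρt) :=
      mul_le_mul_of_nonpos_right h2 (by linarith)
    have h4 : v = h x + deriv h x * (ρt - x) + deriv h x * (m - ρt) := by ring
    linarith
  refine ⟨fun ρ haρ hρm => ?_, fun ρ hmρ => ?_⟩
  · have hma : m - a ≠ 0 := (sub_pos.2 ham).ne'
    have := hconc.affine_le (p := v - (v - h a) / (m - a) * m) (q := (v - h a) / (m - a))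
      ⟨ha, ham.le.trans hmc⟩ ⟨hm.le, hmc⟩ haρ hρm
      (le_of_eq (by field_simp; ring)) (by linarith)
    linarith
  · have hv : v + deriv h x * (ρ - m) = h x + deriv h x * (ρ - x) := by ring
    rw [hv]
    rcases le_total c ρ with hcρ | hρc
    · exact hline ρ hcρ
    · have := hconc.affine_le (p := h x - deriv h x * x) (q := deriv h x)
        ⟨hm.le, hmc⟩ ⟨hc.le, le_rfl⟩ hmρ hρc
        (by linarith [show v = h x + deriv h x * (m - x) from rfl])
        (by linarith [hline c le_rfl])
      linarith

theorem le_integral_of_mem_MADSet {a b m d : ℝ} {P : Measure ℝ} (hP : P ∈ MADSet a b m d)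
    {f : ℝ → ℝ} (hf : ContinuousOn f (Set.Icc a b)) {v σ τ : ℝ}
    (hl : ∀ ρ ∈ Set.Icc a b, ρ ≤ m → v + σ * (ρ - m) ≤ f ρ)
    (hr : ∀ ρ ∈ Set.Icc a b, m ≤ ρ → v + τ * (ρ - m) ≤ f ρ) :
    v + (τ - σ) / 2 * d ≤ ∫ ρ, f ρ ∂P := by
  obtain ⟨hprob, hsupp, hmean, hmad⟩ := hP
  have hae : ∀ᵐ ρ ∂P, ρ ∈ Set.Icc a b := hsupp
  have hint : ∀ g : ℝ → ℝ, ContinuousOn g (Set.Icc a b) → Integrable g P := fun g hg => by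
    rw [← Measure.restrict_eq_self_of_ae_mem hae]
    exact hg.integrableOn_compact isCompact_Icc
  have hi1 : Integrable (fun ρ : ℝ => ρ) P := hint _ continuousOn_id
  have hi2 : Integrable (fun ρ : ℝ => |ρ - m|) P := hint _ (by fun_prop)
  have hi3 : Integrable (fun ρ : ℝ => v - (σ + τ) / 2 * m + (σ + τ) / 2 * ρ) P :=
    hint _ (by fun_prop)
  have hval : ∫ ρ, (v - (σ + τ) / 2 * m + (σ + τ) / 2 * ρ + (τ - σ) / 2 * |ρ - m|) ∂P =
      v + (τ - σ) / 2 * d := by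
    rw [integral_add hi3 (hi2.const_mul _),
      integral_add (integrable_const _) (hi1.const_mul _), integral_const_mul, integral_const_mul,
      hmean, hmad]
    simp
  rw [← hval]
  refine integral_mono_ae (hi3.add (hi2.const_mul _)) (hint f hf) ?_
  filter_upwards [hae] with ρ hρ
  rcases le_total ρ m with h | h
  · rw [abs_of_nonpos (by linarith)]
    linarith [hl ρ hρ h]
  · rw [abs_of_nonneg (by linarith)]
    linarith [hr ρ hρ h]

theorem integral_two_dirac {p q : ℝ} (hp : 0 ≤ p) (hq : 0 ≤ q) (x y : ℝ) (f : ℝ → ℝ) :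
    ∫ ρ, f ρ ∂(ENNReal.ofReal p • Measure.dirac x + ENNReal.ofReal q • Measure.dirac y) =
      p * f x + q * f y := by
  have hi : ∀ (r z : ℝ), Integrable f (ENNReal.ofReal r • Measure.dirac z) := fun r z =>
    (integrable_dirac (by simp)).smul_measure ENNReal.ofReal_ne_top
  rw [integral_add_measure (hi _ _) (hi _ _)]
  simp [integral_smul_measure, ENNReal.toReal_ofReal, hp, hq]

/-- Case 3 of Proposition 3: if `f_n(b) + f_n'(b)(m-b) < f_n(m)` and `d ≥ d₀`, the
worst-case expected social benefit rate is attained by a two-point distribution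
supported on `{a, ρ₂}` with `ρ₂ = (ad + 2m(a−m))/(d + 2(a−m))`. -/
theorem stmt8 (R C μ : ℝ) (hR : 0 < R) (hC : 0 < C) (hμ : 0 < μ)
    (n : ℕ) (hn : 1 ≤ n) (hRC : (n : ℝ) + 1 ≤ R * μ / C)
    (a b m d : ℝ) (ha : 0 ≤ a) (ham : a < m) (hmb : m < b) (hm1 : m ≤ 1)
    (hd0 : 0 < d) (hd : d < 2 * (m - a) * (b - m) / (b - a))
    (hcase : socialRate R C μ n b + deriv (socialRate R C μ n) b * (m - b) <
      socialRate R C μ n m)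
    (ρt : ℝ) (hρt : ρt ∈ Set.Ioo m b)
    (htangent : socialRate R C μ n ρt + deriv (socialRate R C μ n) ρt * (m - ρt) =
      socialRate R C μ n m)
    (hdd0 : 2 * (m - a) * (ρt - m) / (ρt - a) ≤ d) :
    let p₁ : ℝ := d / (2 * (m - a))
    let p₂ : ℝ := 1 - p₁
    let ρ₂ : ℝ := (a * d + 2 * m * (a - m)) / (d + 2 * (a - m))
    let Pstar : Measure ℝ :=
      ENNReal.ofReal p₁ • Measure.dirac a + ENNReal.ofReal p₂ • Measure.dirac ρ₂
    sInf ((fun P => ∫ ρ, socialRate R C μ n ρ ∂P) '' MADSet a b m d) =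
      p₁ * socialRate R C μ n a + p₂ * socialRate R C μ n ρ₂ ∧
    Pstar ∈ MADSet a b m d ∧
    (∫ ρ, socialRate R C μ n ρ ∂Pstar) =
      p₁ * socialRate R C μ n a + p₂ * socialRate R C μ n ρ₂ := by
  intro p₁ p₂ ρ₂ Pstar
  have hma : 0 < m - a := sub_pos.2 ham
  have hm : 0 < m := ha.trans_lt ham
  have hmt := hρt.1
  have hd' : d * (b - a) < 2 * (m - a) * (b - m) := (lt_div_iff₀ (by linarith)).1 hd
  have hdt : 2 * (m - a) * (ρt - m) ≤ d * (ρt - a) := (div_le_iff₀ (by linarith)).1 hdd0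
  have he : 0 < 2 * (m - a) - d := by nlinarith
  have hp₁ : 0 ≤ p₁ := by positivity
  have hp₁m : p₁ * (m - a) = d / 2 := by
    simp only [p₁]
    field_simp
  have hp₂e : p₂ * (2 * (m - a)) = 2 * (m - a) - d := by
    simp only [p₂]
    linear_combination -2 * hp₁m
  have hp₂ : 0 ≤ p₂ := by
    by_contra! h
    nlinarith
  have hρ₂ : (ρ₂ - m) * (2 * (m - a) - d) = d * (m - a) := by
    have : d + 2 * (a - m) ≠ 0 := by linarith
    simp only [ρ₂]
    field_simp
    ring
  have hp₂m : p₂ * (ρ₂ - m) = d / 2 := by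
    refine mul_right_cancel₀ (mul_pos two_pos hma).ne' ?_
    linear_combination (ρ₂ - m) * hp₂e + hρ₂
  have htρ₂ : ρt ≤ ρ₂ := by
    by_contra! h
    nlinarith
  have hρ₂b : ρ₂ ≤ b := by
    by_contra! h
    nlinarith
  have hmean : p₁ * a + p₂ * ρ₂ = m := by
    simp only [p₂] at hp₂m ⊢
    linear_combination hp₂m - hp₁m
  have hsum : p₁ + p₂ = 1 := add_sub_cancel p₁ 1
  have hval : ∀ f : ℝ → ℝ, ∫ ρ, f ρ ∂Pstar = p₁ * f a + p₂ * f ρ₂ :=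
    integral_two_dirac hp₁ hp₂ a ρ₂
  have hPstar : Pstar ∈ MADSet a b m d := by
    refine ⟨⟨?_⟩, ?_, ?_, ?_⟩
    · simp [Pstar, ← ENNReal.ofReal_add hp₁ hp₂, hsum]
    · have h1 : a ∈ Set.Icc a b := ⟨le_rfl, (ham.trans hmb).le⟩
      have h2 : ρ₂ ∈ Set.Icc a b := ⟨by linarith, hρ₂b⟩
      simp only [Pstar, Measure.add_apply, Measure.smul_apply,
        Measure.dirac_apply' _ measurableSet_Icc.compl]
      simp [h1.2, h2.1, h2.2]
    · rw [hval, hmean]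
    · rw [hval, abs_of_neg (by linarith), abs_of_pos (by linarith)]
      linear_combination hp₁m + hp₂m
  refine ⟨IsLeast.csInf_eq ⟨⟨Pstar, hPstar, hval _⟩, ?_⟩, hPstar, hval _⟩
  rintro _ ⟨P, hP, rfl⟩
  rw [deriv_socialRate_eq R C μ n (hm.trans hmt), socialRate_eq_smoothRate R C μ n hm.le,
    socialRate_eq_smoothRate R C μ n (hm.trans hmt).le] at htangent
  obtain ⟨c, h1c, hct, hanti, hmono⟩ := exists_inflection_smoothRate hC hn hRC hm hmt htangent
  obtain ⟨hl, hr⟩ := kinked_minorant_of_concave_convex ha ham (hm1.trans h1c) hct htρ₂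
    (continuousOn_smoothRate R C μ n) (fun y hy =>
      (contDiffAt_smoothRate R C μ n hy.le).differentiableAt (by norm_num)) hanti hmono htangent
  have heq : ∀ ρ ∈ Set.Icc a b, socialRate R C μ n ρ = smoothRate R C μ n ρ := fun ρ hρ =>
    socialRate_eq_smoothRate R C μ n (ha.trans hρ.1)
  have hbound := le_integral_of_mem_MADSet hP
    (((continuousOn_smoothRate R C μ n).mono fun ρ hρ => ha.trans hρ.1).congr heq)
    (fun ρ hρ h => (hl ρ hρ.1 h).trans_eq (heq ρ hρ).symm)
    (fun ρ hρ h => (hr ρ h).trans_eq (heq ρ hρ).symm)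
  refine le_of_eq_of_le ?_ hbound
  rw [heq a ⟨le_rfl, (ham.trans hmb).le⟩, heq ρ₂ ⟨by linarith, hρ₂b⟩]
  set f := smoothRate R C μ n
  set v := f ρ₂ + deriv f ρ₂ * (m - ρ₂) with hv
  have hσ : (v - f a) / (m - a) * (m - a) = v - f a := div_mul_cancel₀ _ hma.ne'
  set σ := (v - f a) / (m - a)
  linear_combination (v : ℝ) * hsum - σ * hp₁m + deriv f ρ₂ * hp₂m + p₁ * hσ - p₂ * hv
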